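/- There exists a transcendental self-map f of ℂ* that has a doubly connected Baker domain; that is, there is a Fatou component U of f with f(U) ⊆ U and U ⊆ I(f) such that U is doubly connected (in fact U contains a circle {z : |z| = ρ} centered at 0 for some ρ > 0). -/

import Mathlib

open Complex Topology Filter Set Function OnePoint

noncomputable section

/-- The chordal (spherical) distance on the Riemann sphere, restricted to finite points. -/
def chordalDist (z w : ℂ) : ℝ :=
  ‖z - w‖ / Real.sqrt ((1 + ‖z‖ ^ 2) * (1 + ‖w‖ ^ 2))

/-- A transcendental self-map of `ℂ* = ℂ \ {0}`: a holomorphic self-map of the punctured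
plane with essential singularities at `0` and `∞`; equivalently, on `ℂ*` it has the form
`z ^ m * exp (g z + h z⁻¹)` for some `m : ℤ` and nonconstant entire functions `g, h`. -/
def IsTranscendentalSelfMapCStar (f : ℂ → ℂ) : Prop :=
  ∃ (m : ℤ) (g h : ℂ → ℂ),
    Differentiable ℂ g ∧ Differentiable ℂ h ∧
    (¬ ∃ c : ℂ, ∀ z, g z = c) ∧ (¬ ∃ c : ℂ, ∀ z, h z = c) ∧
    ∀ z : ℂ, z ≠ 0 → f z = z ^ m * Complex.exp (g z + h z⁻¹)

/-- The escaping set `I(f)` of a self-map of the punctured plane: points whose orbit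
accumulates only at `0` and `∞`. -/
def escapingSet (f : ℂ → ℂ) : Set ℂ :=
  {z | z ≠ 0 ∧ ∀ ε : ℝ, 0 < ε → ∃ N : ℕ, ∀ n ≥ N,
    ‖f^[n] z‖ < ε ∨ 1 / ε < ‖f^[n] z‖}

/-- The little escaping set `I_e(f)` with essential itinerary `e` (where `true` stands for the
symbol `∞` and `false` for the symbol `0`). -/
def littleEscapingSet (f : ℂ → ℂ) (e : ℕ → Bool) : Set ℂ :=
  {z | z ∈ escapingSet f ∧ ∃ ℓ k : ℕ, ∀ n : ℕ,
    (1 < ‖f^[n + ℓ] z‖ ↔ e (n + k) = true)}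

/-- The immediate little escaping set `Ĩ_e(f)`. -/
def immediateLittleEscapingSet (f : ℂ → ℂ) (e : ℕ → Bool) : Set ℂ :=
  {z | z ∈ escapingSet f ∧ ∃ ℓ : ℕ, ∀ n : ℕ,
    (1 < ‖f^[n + ℓ] z‖ ↔ e (n + ℓ) = true)}

/-- The Fatou set of a self-map of the punctured plane: points of `ℂ*` with a neighbourhood
(inside `ℂ*`) on which the family of iterates is equicontinuous w.r.t. the chordal metric. -/
def FatouSet (f : ℂ → ℂ) : Set ℂ :=
  {z | z ≠ 0 ∧ ∃ U : Set ℂ, IsOpen U ∧ z ∈ U ∧ (∀ w ∈ U, w ≠ 0) ∧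
    ∀ w ∈ U, ∀ ε : ℝ, 0 < ε → ∃ δ : ℝ, 0 < δ ∧ ∀ w' ∈ U,
      chordalDist w w' < δ → ∀ n : ℕ, chordalDist (f^[n] w) (f^[n] w') < ε}

/-- The Julia set `J(f) = ℂ* \ F(f)`. -/
def JuliaSet (f : ℂ → ℂ) : Set ℂ := {z : ℂ | z ≠ 0} \ FatouSet f

/-- A Fatou component: a connected component of the Fatou set. -/
def IsFatouComponent (f : ℂ → ℂ) (U : Set ℂ) : Prop :=
  ∃ z ∈ FatouSet f, U = connectedComponentIn (FatouSet f) z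

/-- A wandering domain: a Fatou component `U` such that the Fatou components containing the
iterated images `fⁿ(U)` are pairwise distinct. -/
def IsWanderingDomain (f : ℂ → ℂ) (U : Set ℂ) : Prop :=
  IsFatouComponent f U ∧ ∃ V : ℕ → Set ℂ, V 0 = U ∧
    (∀ n, IsFatouComponent f (V n)) ∧
    (∀ n, f '' V n ⊆ V (n + 1)) ∧ Function.Injective V

/-- A set is bounded in `ℂ*` if it lies in some closed annulus `{r ≤ |z| ≤ R}`. -/
def BoundedInCStar (X : Set ℂ) : Prop :=
  ∃ r R : ℝ, 0 < r ∧ r ≤ R ∧ X ⊆ {z : ℂ | r ≤ ‖z‖ ∧ ‖z‖ ≤ R}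

/-- The boundary of a subset of `ℂ*` taken in `ℂ*`. -/
def boundaryInCStar (G : Set ℂ) : Set ℂ := frontier G \ {0}

/-- The set `I(f) ∪ {0, ∞}` regarded as a subset of the Riemann sphere `ℂ̂ = ℂ ∪ {∞}`. -/
def escapingSphere (f : ℂ → ℂ) : Set (OnePoint ℂ) :=
  ((fun z : ℂ => (z : OnePoint ℂ)) '' escapingSet f) ∪ {((0 : ℂ) : OnePoint ℂ), ∞}

/-- The set `I_e(f) ∪ {0, ∞}` regarded as a subset of the Riemann sphere. -/
def littleEscapingSphere (f : ℂ → ℂ) (e : ℕ → Bool) : Set (OnePoint ℂ) :=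
  ((fun z : ℂ => (z : OnePoint ℂ)) '' littleEscapingSet f e) ∪ {((0 : ℂ) : OnePoint ℂ), ∞}

/-- A subset of the sphere has exactly two connected components. -/
def HasExactlyTwoComponents (K : Set (OnePoint ℂ)) : Prop :=
  ∃ x ∈ K, ∃ y ∈ K, connectedComponentIn K x ≠ connectedComponentIn K y ∧
    ∀ z ∈ K, connectedComponentIn K z = connectedComponentIn K x ∨
      connectedComponentIn K z = connectedComponentIn K y

/-- A domain `U ⊆ ℂ*` is doubly connected if its complement in the Riemann sphere has
exactly two connected components. -/
def DoublyConnected (U : Set ℂ) : Prop :=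
  HasExactlyTwoComponents (((fun z : ℂ => (z : OnePoint ℂ)) '' U)ᶜ)

/-- A transcendental entire function. -/
def IsTranscendentalEntire (f : ℂ → ℂ) : Prop :=
  Differentiable ℂ f ∧ ¬ ∃ p : Polynomial ℂ, ∀ z, f z = p.eval z

/-- The Fatou set of an entire function. -/
def FatouSetEntire (f : ℂ → ℂ) : Set ℂ :=
  {z | ∃ U : Set ℂ, IsOpen U ∧ z ∈ U ∧
    ∀ w ∈ U, ∀ ε : ℝ, 0 < ε → ∃ δ : ℝ, 0 < δ ∧ ∀ w' ∈ U,
      chordalDist w w' < δ → ∀ n : ℕ, chordalDist (f^[n] w) (f^[n] w') < ε}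

/-- The Julia set of an entire function. -/
def JuliaSetEntire (f : ℂ → ℂ) : Set ℂ := (FatouSetEntire f)ᶜ

/-- `f` has a finite asymptotic value. -/
def HasFiniteAsymptoticValue (f : ℂ → ℂ) : Prop :=
  ∃ (a : ℂ) (γ : ℝ → ℂ), ContinuousOn γ (Set.Ici (0 : ℝ)) ∧
    Tendsto (fun t => ‖γ t‖) atTop atTop ∧
    Tendsto (fun t => f (γ t)) atTop (nhds a)

/-! ### The chordal distance -/

lemma chordalDist_comm (z w : ℂ) : chordalDist z w = chordalDist w z := by
  unfold chordalDist
  rw [norm_sub_rev, mul_comm]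

lemma chordalDist_le_norm_sub (z w : ℂ) : chordalDist z w ≤ ‖z - w‖ := by
  unfold chordalDist
  refine div_le_self (norm_nonneg _) ?_
  rw [Real.one_le_sqrt]
  nlinarith [sq_nonneg ‖z‖, sq_nonneg ‖w‖, mul_nonneg (sq_nonneg ‖z‖) (sq_nonneg ‖w‖)]

lemma norm_sub_le_mul_chordalDist {z w : ℂ} {R : ℝ} (hz : ‖z‖ ≤ R) (hw : ‖w‖ ≤ R) :
    ‖z - w‖ ≤ (1 + R ^ 2) * chordalDist z w := by
  unfold chordalDist
  have h1 : 0 < Real.sqrt ((1 + ‖z‖ ^ 2) * (1 + ‖w‖ ^ 2)) := Real.sqrt_pos.2 (by positivity)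
  have h2 : Real.sqrt ((1 + ‖z‖ ^ 2) * (1 + ‖w‖ ^ 2)) ≤ 1 + R ^ 2 := by
    rw [Real.sqrt_le_left (by positivity), sq (1 + R ^ 2)]
    gcongr
  rw [mul_div_assoc', le_div_iff₀ h1, mul_comm]
  gcongr

lemma chordalDist_le_two_div {z w : ℂ} {M : ℝ} (hM : 0 < M) (hz : M < ‖z‖) (hw : M < ‖w‖) :
    chordalDist z w ≤ 2 / M := by
  unfold chordalDist
  have hz0 := hM.trans hz
  have hw0 := hM.trans hw
  have h1 : ‖z‖ * ‖w‖ ≤ Real.sqrt ((1 + ‖z‖ ^ 2) * (1 + ‖w‖ ^ 2)) := by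
    apply Real.le_sqrt_of_sq_le
    rw [mul_pow]
    gcongr <;> linarith
  calc ‖z - w‖ / Real.sqrt ((1 + ‖z‖ ^ 2) * (1 + ‖w‖ ^ 2))
      ≤ (‖z‖ + ‖w‖) / (‖z‖ * ‖w‖) := by
        gcongr
        exact norm_sub_le z w
    _ ≤ 2 / M := by
        rw [div_le_div_iff₀ (by positivity) hM]
        nlinarith

lemma lt_norm_of_chordalDist_lt {a b : ℂ} {M : ℝ} (hM : 0 ≤ M) (ha : 2 * M + 1 ≤ ‖a‖)
    (h : chordalDist a b < 1 / (2 * (1 + M))) : M < ‖b‖ := by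
  by_contra! hb
  refine h.not_ge ?_
  unfold chordalDist
  have h1 : Real.sqrt ((1 + ‖a‖ ^ 2) * (1 + ‖b‖ ^ 2)) ≤ (1 + ‖a‖) * (1 + M) := by
    rw [Real.sqrt_le_left (by positivity), mul_pow]
    gcongr
    · nlinarith [norm_nonneg a]
    · nlinarith [norm_nonneg b]
  have h2 : 0 < Real.sqrt ((1 + ‖a‖ ^ 2) * (1 + ‖b‖ ^ 2)) := Real.sqrt_pos.2 (by positivity)
  have h3 : ‖a‖ - ‖b‖ ≤ ‖a - b‖ := norm_sub_norm_le a b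
  rw [div_le_div_iff₀ (by positivity) h2]
  nlinarith

/-! ### Uniform escape to infinity and the Fatou set -/

/-- The iterates of `f` tend to `∞` uniformly on `V`. -/
def EscapesUniformlyOn (f : ℂ → ℂ) (V : Set ℂ) : Prop :=
  ∀ M : ℝ, ∃ N : ℕ, ∀ n ≥ N, ∀ w ∈ V, M < ‖f^[n] w‖

lemma EscapesUniformlyOn.mono {f : ℂ → ℂ} {V W : Set ℂ} (h : EscapesUniformlyOn f V)
    (hWV : W ⊆ V) : EscapesUniformlyOn f W := fun M =>
  (h M).imp fun _ hN n hn w hw => hN n hn w (hWV hw)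

lemma EscapesUniformlyOn.image {f : ℂ → ℂ} {V : Set ℂ} (h : EscapesUniformlyOn f V) :
    EscapesUniformlyOn f (f '' V) := by
  intro M
  obtain ⟨N, hN⟩ := h M
  refine ⟨N, ?_⟩
  rintro n hn _ ⟨w, hw, rfl⟩
  rw [← iterate_succ_apply]
  exact hN _ (by omega) w hw

lemma subset_fatouSet_of_escapesUniformlyOn {f : ℂ → ℂ} {V : Set ℂ} (hV : IsOpen V)
    (h0 : ∀ w ∈ V, w ≠ 0) (hc : ∀ n, ContinuousOn f^[n] V) (hesc : EscapesUniformlyOn f V) :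
    V ⊆ FatouSet f := by
  intro z hz
  refine ⟨h0 z hz, V ∩ Metric.ball 0 (‖z‖ + 1), hV.inter Metric.isOpen_ball, ⟨hz, by simp⟩,
    fun w hw => h0 w hw.1, ?_⟩
  intro w hw ε hε
  obtain ⟨N, hN⟩ := hesc (3 / ε)
  have hev : ∀ᶠ w' in 𝓝[V] w, ∀ n ∈ Finset.range N, dist (f^[n] w') (f^[n] w) < ε := by
    rw [Filter.eventually_all_finset]
    intro n _
    exact (hc n w hw.1).eventually (Metric.ball_mem_nhds _ hε)
  obtain ⟨η, hη, hball⟩ := Metric.mem_nhdsWithin_iff.1 hev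
  set R := ‖z‖ + 1 with hR
  refine ⟨η / (1 + R ^ 2), by positivity, fun w' hw' hd n => ?_⟩
  have hwR : ‖w‖ ≤ R := (mem_ball_zero_iff.1 hw.2).le
  have hwR' : ‖w'‖ ≤ R := (mem_ball_zero_iff.1 hw'.2).le
  rcases lt_or_ge n N with hn | hn
  · have h1 : ‖w - w'‖ < η := by
      refine (norm_sub_le_mul_chordalDist hwR hwR').trans_lt ?_
      rwa [lt_div_iff₀' (by positivity)] at hd
    have h2 := hball ⟨by rwa [Metric.mem_ball, dist_comm, dist_eq_norm], hw'.1⟩ n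
      (Finset.mem_range.2 hn)
    refine (chordalDist_le_norm_sub _ _).trans_lt ?_
    rwa [dist_comm, dist_eq_norm] at h2
  · refine (chordalDist_le_two_div (M := 3 / ε) (by positivity) (hN n hn w hw.1)
      (hN n hn w' hw'.1)).trans_lt ?_
    rw [div_div_eq_mul_div, div_lt_iff₀ (by norm_num)]
    linarith

lemma isOpen_fatouSet (f : ℂ → ℂ) : IsOpen (FatouSet f) := by
  rw [isOpen_iff_forall_mem_open]
  rintro z ⟨_, V, hV, hzV, hV0, hVeq⟩
  exact ⟨V, fun w hw => ⟨hV0 w hw, V, hV, hw, hV0, hVeq⟩, hV, hzV⟩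

/-- Points of the Fatou set whose iterates tend to `∞`. -/
def fatouToInfinity (f : ℂ → ℂ) : Set ℂ :=
  {z | z ∈ FatouSet f ∧ Tendsto (fun n => ‖f^[n] z‖) atTop atTop}

lemma exists_ball_chordalDist_lt {f : ℂ → ℂ} {z : ℂ} (hz : z ∈ FatouSet f) {ε : ℝ} (hε : 0 < ε) :
    ∃ r > 0, ∀ w ∈ Metric.ball z r, w ∈ FatouSet f ∧
      ∀ n, chordalDist (f^[n] z) (f^[n] w) < ε := by
  obtain ⟨hz0, V, hV, hzV, hV0, hVeq⟩ := hz
  obtain ⟨δ, hδ, h⟩ := hVeq z hzV ε hε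
  obtain ⟨r, hr, hrV⟩ := Metric.isOpen_iff.1 hV z hzV
  refine ⟨min r δ, lt_min hr hδ, fun w hw => ?_⟩
  have hwV : w ∈ V := hrV (Metric.ball_subset_ball (min_le_left _ _) hw)
  refine ⟨⟨hV0 w hwV, V, hV, hwV, hV0, hVeq⟩, h w hwV ?_⟩
  refine (chordalDist_le_norm_sub _ _).trans_lt ?_
  rw [← dist_eq_norm, dist_comm]
  exact (Metric.mem_ball.1 hw).trans_le (min_le_right _ _)

lemma exists_ball_lt_norm_iterate {f : ℂ → ℂ} {z : ℂ} (hz : z ∈ fatouToInfinity f) (M : ℝ) :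
    ∃ r > 0, ∃ N, Metric.ball z r ⊆ FatouSet f ∧
      ∀ n ≥ N, ∀ w ∈ Metric.ball z r, M < ‖f^[n] w‖ := by
  have hM : 0 ≤ max M 0 := le_max_right _ _
  obtain ⟨r, hr, h⟩ := exists_ball_chordalDist_lt hz.1
    (ε := 1 / (2 * (1 + max M 0))) (by positivity)
  obtain ⟨N, hN⟩ := (tendsto_atTop.1 hz.2 (2 * max M 0 + 1)).exists_forall_of_atTop
  refine ⟨r, hr, N, fun w hw => (h w hw).1, fun n hn w hw => ?_⟩
  exact (le_max_left _ _).trans_lt (lt_norm_of_chordalDist_lt hM (hN n hn) ((h w hw).2 n))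

lemma escapesUniformlyOn_of_isCompact {f : ℂ → ℂ} {K : Set ℂ} (hK : IsCompact K)
    (hKf : K ⊆ fatouToInfinity f) : EscapesUniformlyOn f K := by
  intro M
  refine hK.induction_on (p := fun s => ∃ N : ℕ, ∀ n ≥ N, ∀ w ∈ s, M < ‖f^[n] w‖)
    ⟨0, by simp⟩ ?_ ?_ ?_
  · exact fun s t hst ⟨N, hN⟩ => ⟨N, fun n hn w hw => hN n hn w (hst hw)⟩
  · rintro s t ⟨N, hN⟩ ⟨N', hN'⟩
    refine ⟨max N N', fun n hn w hw => hw.elim (hN n ?_ w) (hN' n ?_ w)⟩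
    · exact (le_max_left _ _).trans hn
    · exact (le_max_right _ _).trans hn
  · intro x hx
    obtain ⟨r, hr, N, -, hN⟩ := exists_ball_lt_norm_iterate (hKf hx) M
    exact ⟨_, mem_nhdsWithin_of_mem_nhds (Metric.ball_mem_nhds x hr), N, hN⟩

lemma mem_fatouToInfinity_of_closure {f : ℂ → ℂ} {z : ℂ} (hz : z ∈ FatouSet f)
    (hcl : z ∈ closure (fatouToInfinity f)) : z ∈ fatouToInfinity f := by
  refine ⟨hz, tendsto_atTop.2 fun M => ?_⟩
  have hM : 0 ≤ max M 0 := le_max_right _ _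
  obtain ⟨r, hr, h⟩ := exists_ball_chordalDist_lt hz
    (ε := 1 / (2 * (1 + max M 0))) (by positivity)
  obtain ⟨w, hw, hwz⟩ := Metric.mem_closure_iff.1 hcl r hr
  filter_upwards [tendsto_atTop.1 hw.2 (2 * max M 0 + 1)] with n hn
  have h1 := (h w (by rwa [Metric.mem_ball, dist_comm])).2 n
  rw [chordalDist_comm] at h1
  exact (le_max_left _ _).trans (lt_norm_of_chordalDist_lt hM hn h1).le

/-! ### Harnack's inequality and the set of points escaping to infinity -/

lemma re_le_three_mul_re {φ : ℂ → ℂ} {w z : ℂ} {R : ℝ}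
    (hφ : DifferentiableOn ℂ φ (Metric.ball w R)) (hpos : ∀ ζ ∈ Metric.ball w R, 0 < (φ ζ).re)
    (hz : 2 * ‖z - w‖ < R) : (φ z).re ≤ 3 * (φ w).re := by
  have hR : 0 < R := lt_of_le_of_lt (by positivity) hz
  have hmaps : MapsTo (fun ζ => ζ + w) (Metric.ball 0 R) (Metric.ball w R) := by
    intro ζ hζ
    simpa [dist_eq_norm] using hζ
  have hw := hpos w (Metric.mem_ball_self hR)
  have key := Complex.borelCaratheodory_zero (f := fun ζ => φ w - φ (ζ + w)) (z := z - w)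
    (R := R) hw ((differentiableOn_const _).sub (hφ.comp (by fun_prop) hmaps))
    (fun ζ hζ => by
      have := hpos _ (hmaps hζ)
      simp only [mem_ofPred_eq, sub_re]
      linarith) hR
    (by rw [mem_ball_zero_iff]; linarith [norm_nonneg (z - w)]) (by simp)
  simp only [sub_add_cancel] at key
  have h1 : (φ z).re - (φ w).re ≤ ‖φ w - φ z‖ := by
    rw [norm_sub_rev, ← sub_re]
    exact Complex.re_le_norm _
  have h2 : 2 * (φ w).re * ‖z - w‖ / (R - ‖z - w‖) ≤ 2 * (φ w).re := by
    have : 0 < R - ‖z - w‖ := by linarith [norm_nonneg (z - w)]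
    rw [div_le_iff₀ this]
    nlinarith
  linarith

section CStarMap

variable {f G : ℂ → ℂ}

lemma iterate_ne_zero_of_exp (hf : ∀ z ≠ 0, f z = Complex.exp (G z)) {z : ℂ} (hz : z ≠ 0) (n : ℕ) :
    f^[n] z ≠ 0 := by
  induction n with
  | zero => exact hz
  | succ n ih =>
    rw [iterate_succ_apply', hf _ ih]
    exact Complex.exp_ne_zero _

lemma differentiableOn_iterate (hG : DifferentiableOn ℂ G {0}ᶜ)
    (hf : ∀ z ≠ 0, f z = Complex.exp (G z)) (n : ℕ) : DifferentiableOn ℂ f^[n] {0}ᶜ := by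
  have h1 : DifferentiableOn ℂ f {0}ᶜ := hG.cexp.congr hf
  exact h1.iterate (fun z hz => iterate_ne_zero_of_exp hf hz 1) n

lemma fatouToInfinity_ne_zero {z : ℂ} (hz : z ∈ fatouToInfinity f) : z ≠ 0 := hz.1.1

lemma isOpen_fatouToInfinity (hG : DifferentiableOn ℂ G {0}ᶜ)
    (hf : ∀ z ≠ 0, f z = Complex.exp (G z)) : IsOpen (fatouToInfinity f) := by
  rw [Metric.isOpen_iff]
  intro z hz
  obtain ⟨r, hr, N, hF, hN⟩ := exists_ball_lt_norm_iterate hz 1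
  refine ⟨r / 3, by positivity, fun w hw => ?_⟩
  rw [mem_ball_iff_norm] at hw
  have hsub : Metric.ball w (2 * r / 3) ⊆ Metric.ball z r :=
    Metric.ball_subset_ball' (by rw [dist_eq_norm]; linarith)
  have hwr : w ∈ Metric.ball z r := by rw [mem_ball_iff_norm]; linarith
  have h0 : ∀ ζ ∈ Metric.ball z r, ζ ≠ 0 := fun ζ hζ => (hF hζ).1
  have hlog : ∀ n, ∀ ζ ∈ Metric.ball z r, ‖f^[n + 1] ζ‖ = Real.exp (G (f^[n] ζ)).re := by
    intro n ζ hζ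
    rw [iterate_succ_apply', hf _ (iterate_ne_zero_of_exp hf (h0 ζ hζ) n), Complex.norm_exp]
  have hzr : z ∈ Metric.ball z r := Metric.mem_ball_self hr
  refine ⟨hF hwr, ?_⟩
  rw [← tendsto_add_atTop_iff_nat 1]
  have hz1 := (tendsto_add_atTop_iff_nat 1).2 hz.2
  simp_rw [hlog _ w hwr]
  simp_rw [hlog _ z hzr, Real.tendsto_exp_comp_atTop] at hz1
  rw [Real.tendsto_exp_comp_atTop]
  refine tendsto_atTop_mono' _ ?_ (hz1.atTop_div_const (by norm_num : (0 : ℝ) < 3))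
  filter_upwards [eventually_ge_atTop N] with n hn
  rw [div_le_iff₀' (by norm_num)]
  refine re_le_three_mul_re (φ := fun ζ => G (f^[n] ζ)) (R := 2 * r / 3) ?_ ?_ ?_
  · refine hG.comp ((differentiableOn_iterate hG hf n).mono ?_) ?_
    · exact fun ζ hζ => h0 ζ (hsub hζ)
    · exact fun ζ hζ => iterate_ne_zero_of_exp hf (h0 ζ (hsub hζ)) n
  · intro ζ hζ
    have := hN (n + 1) (by omega) ζ (hsub hζ)
    rw [hlog n ζ (hsub hζ)] at this
    simpa using this
  · rw [norm_sub_rev]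
    linarith

lemma subset_fatouToInfinity_of_isPreconnected (hG : DifferentiableOn ℂ G {0}ᶜ)
    (hf : ∀ z ≠ 0, f z = Complex.exp (G z)) {S : Set ℂ} (hS : IsPreconnected S)
    (hSF : S ⊆ FatouSet f) (hne : (S ∩ fatouToInfinity f).Nonempty) : S ⊆ fatouToInfinity f :=
  hS.subset_of_closure_inter_subset (isOpen_fatouToInfinity hG hf) hne
    fun _ hz => mem_fatouToInfinity_of_closure (hSF hz.2) hz.1

lemma subset_fatouToInfinity_of_escapesUniformlyOn {V : Set ℂ} (hG : DifferentiableOn ℂ G {0}ᶜ)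
    (hf : ∀ z ≠ 0, f z = Complex.exp (G z)) (hV : IsOpen V) (h0 : ∀ w ∈ V, w ≠ 0)
    (hesc : EscapesUniformlyOn f V) : V ⊆ fatouToInfinity f := by
  intro z hz
  refine ⟨subset_fatouSet_of_escapesUniformlyOn hV h0
    (fun n => (differentiableOn_iterate hG hf n).continuousOn.mono h0) hesc hz, ?_⟩
  rw [tendsto_atTop_atTop]
  exact fun M => (hesc M).imp fun N hN n hn => (hN n hn z hz).le

lemma image_mem_fatouToInfinity (hG : DifferentiableOn ℂ G {0}ᶜ)
    (hf : ∀ z ≠ 0, f z = Complex.exp (G z))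
    (hopen : ∀ V : Set ℂ, V ⊆ {0}ᶜ → IsOpen V → IsOpen (f '' V)) {z : ℂ}
    (hz : z ∈ fatouToInfinity f) : f z ∈ fatouToInfinity f := by
  obtain ⟨r, hr, hball⟩ := Metric.nhds_basis_closedBall.mem_iff.1
    ((isOpen_fatouToInfinity hG hf).mem_nhds hz)
  have hsub : Metric.ball z r ⊆ {0}ᶜ := fun w hw =>
    fatouToInfinity_ne_zero (hball (Metric.ball_subset_closedBall hw))
  have hesc := ((escapesUniformlyOn_of_isCompact (isCompact_closedBall z r) hball).mono
    Metric.ball_subset_closedBall).image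
  refine subset_fatouToInfinity_of_escapesUniformlyOn hG hf (hopen _ hsub Metric.isOpen_ball) ?_
    hesc (mem_image_of_mem f (Metric.mem_ball_self hr))
  rintro _ ⟨w, hw, rfl⟩
  exact iterate_ne_zero_of_exp hf (hsub hw) 1

/-- If the frontier of a bounded open set, with closure in `ℂ*`, lies in the set of points of the
Fatou set escaping to `∞`, then so does the whole set, by the minimum principle. -/
lemma subset_fatouToInfinity_of_frontier (hG : DifferentiableOn ℂ G {0}ᶜ)
    (hf : ∀ z ≠ 0, f z = Complex.exp (G z)) {D : Set ℂ} (hD : IsOpen D)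
    (hDc : IsCompact (closure D)) (hD0 : closure D ⊆ {0}ᶜ)
    (hfr : frontier D ⊆ fatouToInfinity f) : D ⊆ fatouToInfinity f := by
  refine subset_fatouToInfinity_of_escapesUniformlyOn hG hf hD
    (fun w hw => hD0 (subset_closure hw)) fun M => ?_
  have hM : 0 < max M 1 := lt_max_of_lt_right one_pos
  obtain ⟨N, hN⟩ := escapesUniformlyOn_of_isCompact
    (hDc.of_isClosed_subset isClosed_frontier frontier_subset_closure) hfr (max M 1 + 1)
  refine ⟨N, fun n hn w hw => ?_⟩
  have hd : DiffContOnCl ℂ (fun ζ => (f^[n] ζ)⁻¹) D :=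
    (((differentiableOn_iterate hG hf n).mono hD0).inv
      fun ζ hζ => iterate_ne_zero_of_exp hf (hD0 hζ) n).diffContOnCl
  have hle := Complex.norm_le_of_forall_mem_frontier_norm_le (hDc.isBounded.subset subset_closure)
    hd (C := (max M 1 + 1)⁻¹) (fun ζ hζ => by
      rw [norm_inv]
      exact inv_anti₀ (by linarith) (hN n hn ζ hζ).le) (subset_closure hw)
  have hne : 0 < ‖f^[n] w‖ :=
    norm_pos_iff.2 (iterate_ne_zero_of_exp hf (hD0 (subset_closure hw)) n)
  rw [norm_inv, inv_le_inv₀ hne (by linarith)] at hle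
  linarith [le_max_left M 1]

/-- A Fatou component whose points escape to `∞` contains every bounded open set, with closure in
`ℂ*`, whose frontier it contains. -/
lemma subset_connectedComponentIn_of_frontier (hG : DifferentiableOn ℂ G {0}ᶜ)
    (hf : ∀ z ≠ 0, f z = Complex.exp (G z)) {a : ℂ}
    (ha : connectedComponentIn (FatouSet f) a ⊆ fatouToInfinity f) {D : Set ℂ} (hD : IsOpen D)
    (hDc : IsCompact (closure D)) (hD0 : closure D ⊆ {0}ᶜ)
    (hfr : frontier D ⊆ connectedComponentIn (FatouSet f) a) :
    D ⊆ connectedComponentIn (FatouSet f) a := by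
  have hDF : D ⊆ FatouSet f := fun x hx =>
    (subset_fatouToInfinity_of_frontier hG hf hD hDc hD0 (hfr.trans ha) hx).1
  intro x hx
  by_contra hxa
  set V := connectedComponentIn (FatouSet f) x with hV
  have hdisj : Disjoint V (frontier D) := by
    refine Set.disjoint_left.2 fun y hyV hyD => hxa ?_
    rw [connectedComponentIn_eq (hfr hyD), ← connectedComponentIn_eq hyV]
    exact mem_connectedComponentIn (hDF hx)
  have hVD : V ⊆ D := by
    refine isPreconnected_connectedComponentIn.subset_of_closure_inter_subset hD
      ⟨x, mem_connectedComponentIn (hDF hx), hx⟩ ?_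
    rintro y ⟨hyD, hyV⟩
    by_contra hy
    exact Set.disjoint_left.1 hdisj hyV ⟨hyD, by rwa [hD.interior_eq]⟩
  have hclF : closure V ⊆ FatouSet f := by
    refine (closure_mono hVD).trans ?_
    rw [closure_eq_self_union_frontier]
    exact union_subset hDF (hfr.trans (connectedComponentIn_subset _ _))
  have hclosed : IsClosed V := isClosed_of_closure_subset <|
    isPreconnected_connectedComponentIn.closure.subset_connectedComponentIn
      (subset_closure (mem_connectedComponentIn (hDF hx))) hclF
  have huniv := IsClopen.eq_univ ⟨hclosed, (isOpen_fatouSet f).connectedComponentIn⟩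
    ⟨x, mem_connectedComponentIn (hDF hx)⟩
  have h0 : (0 : ℂ) ∈ V := huniv ▸ mem_univ _
  exact hD0 (subset_closure (hVD h0)) rfl

end CStarMap

/-! ### Doubly connected domains -/

lemma exists_isClopen_of_ne_connectedComponentIn {X : Type*} [TopologicalSpace X] [T2Space X]
    {K : Set X} (hK : IsCompact K) {z x : X} (hz : z ∈ K) (hx : x ∈ K)
    (hne : connectedComponentIn K z ≠ connectedComponentIn K x) :
    ∃ s : Set K, IsClopen s ∧ (⟨z, hz⟩ : K) ∈ s ∧ (⟨x, hx⟩ : K) ∉ s := by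
  have := isCompact_iff_compactSpace.1 hK
  by_contra! h
  refine hne (connectedComponentIn_eq ?_)
  rw [connectedComponentIn_eq_image hz]
  refine ⟨⟨x, hx⟩, ?_, rfl⟩
  rw [connectedComponent_eq_iInter_isClopen, mem_iInter]
  exact fun s => h s.1 s.2.1 s.2.2

lemma connectedComponentIn_zero_ne_infty {U : Set ℂ} {ρ : ℝ} (hρ : 0 < ρ)
    (hU : {z : ℂ | ‖z‖ = ρ} ⊆ U) (h0 : (0 : ℂ) ∉ U) :
    connectedComponentIn ((fun z : ℂ => (z : OnePoint ℂ)) '' U)ᶜ ((0 : ℂ) : OnePoint ℂ) ≠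
      connectedComponentIn ((fun z : ℂ => (z : OnePoint ℂ)) '' U)ᶜ ∞ := by
  set K := ((fun z : ℂ => (z : OnePoint ℂ)) '' U)ᶜ with hK
  have hzero : ((0 : ℂ) : OnePoint ℂ) ∈ K := by
    rintro ⟨z, hz, h⟩
    exact h0 (OnePoint.coe_injective h ▸ hz)
  have hinf : ∞ ∈ K := by
    rintro ⟨z, hz, h⟩
    exact OnePoint.coe_ne_infty z h
  intro heq
  set B : Set (OnePoint ℂ) := (fun z : ℂ => (z : OnePoint ℂ)) '' Metric.ball 0 ρ
  have hB : IsOpen B := OnePoint.isOpen_image_coe.2 Metric.isOpen_ball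
  have hsub : connectedComponentIn K ((0 : ℂ) : OnePoint ℂ) ⊆ B := by
    refine isPreconnected_connectedComponentIn.subset_of_closure_inter_subset hB
      ⟨_, mem_connectedComponentIn hzero, 0, Metric.mem_ball_self hρ, rfl⟩ ?_
    rintro y ⟨hyB, hyK⟩
    have hcl : closure B ⊆ (fun z : ℂ => (z : OnePoint ℂ)) '' Metric.closedBall 0 ρ :=
      closure_minimal (image_mono Metric.ball_subset_closedBall)
        (OnePoint.isClosed_image_coe.2 ⟨Metric.isClosed_closedBall, isCompact_closedBall 0 ρ⟩)
    obtain ⟨w, hw, rfl⟩ := hcl hyB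
    refine ⟨w, ?_, rfl⟩
    rw [mem_closedBall_zero_iff] at hw
    rw [mem_ball_zero_iff]
    refine lt_of_le_of_ne hw fun hwρ => ?_
    exact connectedComponentIn_subset _ _ hyK ⟨w, hU hwρ, rfl⟩
  obtain ⟨w, -, hw⟩ := hsub (heq ▸ mem_connectedComponentIn hinf)
  exact OnePoint.coe_ne_infty w hw

/-- An open subset of `ℂ*` separating `0` from `∞` is doubly connected as soon as it contains
every bounded open set, with closure in `ℂ*`, whose frontier it contains. -/
lemma doublyConnected_of_frontier {U : Set ℂ} {ρ : ℝ} (hUo : IsOpen U) (hρ : 0 < ρ)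
    (hU : {z : ℂ | ‖z‖ = ρ} ⊆ U) (h0 : (0 : ℂ) ∉ U)
    (hfill : ∀ D : Set ℂ, IsOpen D → IsCompact (closure D) → closure D ⊆ {0}ᶜ →
      frontier D ⊆ U → D ⊆ U) : DoublyConnected U := by
  have hne := connectedComponentIn_zero_ne_infty hρ hU h0
  unfold DoublyConnected
  set K := ((fun z : ℂ => (z : OnePoint ℂ)) '' U)ᶜ with hK
  have hzero : ((0 : ℂ) : OnePoint ℂ) ∈ K := by
    rintro ⟨z, hz, h⟩
    exact h0 (OnePoint.coe_injective h ▸ hz)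
  have hinf : ∞ ∈ K := by
    rintro ⟨z, hz, h⟩
    exact OnePoint.coe_ne_infty z h
  refine ⟨_, hzero, _, hinf, hne, fun z hz => ?_⟩
  by_contra! hcon
  have hKcl : IsClosed K := (OnePoint.isOpen_image_coe.2 hUo).isClosed_compl
  obtain ⟨s, hs, hzs, h0s⟩ :=
    exists_isClopen_of_ne_connectedComponentIn hKcl.isCompact hz hzero hcon.1
  obtain ⟨t, ht, hzt, hit⟩ :=
    exists_isClopen_of_ne_connectedComponentIn hKcl.isCompact hz hinf hcon.2
  have hst := hs.inter ht
  set L : Set (OnePoint ℂ) := (↑) '' (s ∩ t) with hL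
  set M : Set (OnePoint ℂ) := (↑) '' (s ∩ t)ᶜ with hM
  have hLcl : IsClosed L := hKcl.isClosedEmbedding_subtypeVal.isClosedMap _ hst.1
  have hMcl : IsClosed M := hKcl.isClosedEmbedding_subtypeVal.isClosedMap _ hst.compl.1
  have hLM : Disjoint L M :=
    (Set.disjoint_image_iff Subtype.val_injective).2 disjoint_compl_right
  have hLMK : L ∪ M = K := by
    rw [hL, hM, ← image_union, union_compl_self, image_univ, Subtype.range_coe]
  have hinfL : ∞ ∉ L := by
    rintro ⟨y, hy, hyi⟩
    exact hit ((Subtype.ext hyi : y = ⟨∞, hinf⟩) ▸ hy.2)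
  have hzeroM : ((0 : ℂ) : OnePoint ℂ) ∈ M := ⟨⟨_, hzero⟩, fun h => h0s h.1, rfl⟩
  have hzL : z ∈ L := ⟨⟨z, hz⟩, ⟨hzs, hzt⟩, rfl⟩
  obtain ⟨-, hLc⟩ := (OnePoint.isClosed_iff_of_notMem hinfL).1 hLcl
  have hMc : IsClosed ((↑) ⁻¹' M : Set ℂ) := hMcl.preimage OnePoint.continuous_coe
  obtain ⟨D, hD, hLD, hDM, hDc⟩ := exists_open_between_and_isCompact_closure hLc hMc.isOpen_compl
    fun w hw hw' => Set.disjoint_left.1 hLM hw hw'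
  have hDU : D ⊆ U := by
    refine hfill D hD hDc (fun w hw hw0 => hDM hw ?_) fun w hw => ?_
    · rw [mem_singleton_iff.1 hw0]
      exact hzeroM
    · by_contra hwU
      have hwK : (w : OnePoint ℂ) ∈ K := by
        rintro ⟨y, hy, hyw⟩
        exact hwU (OnePoint.coe_injective hyw ▸ hy)
      rw [← hLMK] at hwK
      rcases hwK with hwL | hwM
      · rw [hD.frontier_eq] at hw
        exact hw.2 (hLD hwL)
      · exact hDM (frontier_subset_closure hw) hwM
  induction z using OnePoint.rec with
  | infty => exact hinfL hzL
  | coe w => exact hz ⟨w, hDU (hLD hzL), rfl⟩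

/-- A criterion for the existence of a doubly connected invariant Fatou component in which the
iterates tend to `∞`. -/
theorem exists_doublyConnected_fatouComponent {f G : ℂ → ℂ} (hG : DifferentiableOn ℂ G {0}ᶜ)
    (hf : ∀ z ≠ 0, f z = Complex.exp (G z))
    (hopen : ∀ V : Set ℂ, V ⊆ {0}ᶜ → IsOpen V → IsOpen (f '' V)) {V Y : Set ℂ} {y : ℂ} {ρ : ℝ}
    (hV : IsOpen V) (hV0 : ∀ w ∈ V, w ≠ 0) (hesc : EscapesUniformlyOn f V)
    (hY : IsPreconnected Y) (hYV : Y ⊆ V) (hy : y ∈ Y) (hfy : f y ∈ Y) (hρ : 0 < ρ)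
    (hρY : {z : ℂ | ‖z‖ = ρ} ⊆ Y) :
    ∃ U : Set ℂ, IsFatouComponent f U ∧ f '' U ⊆ U ∧ U ⊆ escapingSet f ∧
      DoublyConnected U ∧ ∃ ρ : ℝ, 0 < ρ ∧ {z : ℂ | ‖z‖ = ρ} ⊆ U := by
  have hVI := subset_fatouToInfinity_of_escapesUniformlyOn hG hf hV hV0 hesc
  have hYF : Y ⊆ FatouSet f := fun w hw => (hVI (hYV hw)).1
  set U := connectedComponentIn (FatouSet f) y with hU
  have hyU : y ∈ U := mem_connectedComponentIn (hYF hy)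
  have hYU : Y ⊆ U := hY.subset_connectedComponentIn hy hYF
  have hUI : U ⊆ fatouToInfinity f :=
    subset_fatouToInfinity_of_isPreconnected hG hf isPreconnected_connectedComponentIn
      (connectedComponentIn_subset _ _) ⟨y, hyU, hVI (hYV hy)⟩
  have hU0 : U ⊆ {0}ᶜ := fun w hw => fatouToInfinity_ne_zero (hUI hw)
  refine ⟨U, ⟨y, hYF hy, rfl⟩, ?_, fun z hz => ⟨hU0 hz, fun ε _ => ?_⟩, ?_, ρ, hρ,
    hρY.trans hYU⟩
  · have hfU : IsPreconnected (f '' U) := isPreconnected_connectedComponentIn.image _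
      ((differentiableOn_iterate hG hf 1).continuousOn.mono hU0)
    refine (hfU.subset_connectedComponentIn (mem_image_of_mem f hyU) ?_).trans
      (connectedComponentIn_eq (hYU hfy)).ge
    rintro _ ⟨w, hw, rfl⟩
    exact (image_mem_fatouToInfinity hG hf hopen (hUI hw)).1
  · obtain ⟨N, hN⟩ := ((hUI hz).2.eventually_gt_atTop (1 / ε)).exists_forall_of_atTop
    exact ⟨N, fun n hn => Or.inr (hN n hn)⟩
  · exact doublyConnected_of_frontier (isOpen_fatouSet f).connectedComponentIn hρ
      (hρY.trans hYU) (fun h => hU0 h rfl)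
      fun D hD hDc hD0 hfr => subset_connectedComponentIn_of_frontier hG hf hUI hD hDc hD0 hfr

/-! ### An entire function close to the logarithm in the right half-plane -/

/-- The entire function `∫₀ᶻ (1 - exp (-t)) / t dt`, characterised by its properties. -/
lemma exists_entire_near_log : ∃ g : ℂ → ℂ, Differentiable ℂ g ∧ g 0 = 0 ∧
    (∀ z ≠ 0, HasDerivAt g ((1 - Complex.exp (-z)) / z) z) ∧
    (∀ x : ℝ, 0 ≤ x → g x = ((g x).re : ℂ) ∧ 0 ≤ (g x).re) ∧
    ∀ x : ℝ, 1 ≤ x → Real.log x - 1 ≤ (g x).re := by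
  set F : ℂ → ℂ := fun z => 1 - Complex.exp (-z) with hF
  have hFd : Differentiable ℂ F := by fun_prop
  have hdd : Differentiable ℂ (dslope F 0) := by
    rw [← differentiableOn_univ, differentiableOn_dslope Filter.univ_mem, differentiableOn_univ]
    exact hFd
  obtain ⟨g, hg0, hg⟩ := hdd.isExactOn_univ.with_val_at 0 0
  replace hg : ∀ z, HasDerivAt g (dslope F 0 z) z := fun z => hg z (mem_univ z)
  have hne : ∀ z ≠ 0, dslope F 0 z = (1 - Complex.exp (-z)) / z := by
    intro z hz
    rw [dslope_of_ne _ hz, slope_def_field]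
    simp [hF]
  have hzero : dslope F 0 0 = 1 := by
    rw [dslope_same]
    have : HasDerivAt F 1 0 := by
      simpa using ((hasDerivAt_id (0 : ℂ)).neg.cexp).const_sub 1
    exact this.deriv
  have hreal : ∀ x : ℝ, ∃ d : ℝ, 0 ≤ d ∧ dslope F 0 x = d ∧
      (x ≠ 0 → d = (1 - Real.exp (-x)) / x) := by
    intro x
    rcases eq_or_ne x 0 with rfl | hx
    · exact ⟨1, zero_le_one, by simpa using hzero, fun h => (h rfl).elim⟩
    · refine ⟨(1 - Real.exp (-x)) / x, ?_, ?_, fun _ => rfl⟩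
      · rcases hx.lt_or_gt with h | h
        · refine div_nonneg_of_nonpos ?_ h.le
          have := Real.one_le_exp (x := -x) (by linarith)
          linarith
        · refine div_nonneg ?_ h.le
          have := Real.exp_le_one_iff.2 (show -x ≤ 0 by linarith)
          linarith
      · rw [hne _ (by exact_mod_cast hx)]
        push_cast
        rfl
  choose d hd0 hd hdx using hreal
  have hre : ∀ x : ℝ, HasDerivAt (fun x : ℝ => (g x).re) (d x) x := by
    intro x
    have := (hg x).real_of_complex
    rwa [hd, ofReal_re] at this
  have him : ∀ x : ℝ, (g x).im = 0 := by
    have h1 : ∀ x : ℝ, HasDerivAt (fun x : ℝ => (g x).im) 0 x := by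
      intro x
      have := ((hg x).const_mul (-I)).real_of_complex
      simpa [hd] using this
    intro x
    have := is_const_of_deriv_eq_zero (fun x => (h1 x).differentiableAt)
      (fun x => (h1 x).deriv) x 0
    simpa [hg0] using this
  have hmono : Monotone fun x : ℝ => (g x).re :=
    monotone_of_deriv_nonneg (fun x => (hre x).differentiableAt)
      fun x => by rw [(hre x).deriv]; exact hd0 x
  refine ⟨g, fun z => (hg z).differentiableAt, hg0, fun z hz => hne z hz ▸ hg z,
    fun x hx => ⟨?_, ?_⟩, ?_⟩
  · exact Complex.ext (by simp) (by simp [him])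
  · simpa [hg0] using hmono hx
  · intro x hx
    have hder : ∀ t : ℝ, 1 ≤ t → HasDerivAt (fun t : ℝ => (g t).re - Real.log t - Real.exp (-t))
        (d t - t⁻¹ - Real.exp (-t) * (-1)) t := by
      intro t ht
      exact ((hre t).sub (Real.hasDerivAt_log (by linarith))).sub (hasDerivAt_neg t).exp
    have hmonoOn := monotoneOn_of_deriv_nonneg (convex_Ici (1 : ℝ))
      (fun t ht => (hder t ht).continuousAt.continuousWithinAt)
      (fun t ht => (hder t (interior_subset ht)).differentiableAt.differentiableWithinAt)
      (fun t ht => by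
        have ht1 : 1 ≤ t := interior_subset ht
        have ht0 : 0 < t := by linarith
        rw [(hder t ht1).deriv, hdx t ht0.ne']
        have h2 : (1 - Real.exp (-t)) / t - t⁻¹ - Real.exp (-t) * (-1)
            = Real.exp (-t) * (1 - t⁻¹) := by
          field_simp
          ring
        rw [h2]
        exact mul_nonneg (Real.exp_pos _).le (sub_nonneg.2 (inv_le_one_of_one_le₀ ht1)))
    have h3 := hmonoOn (mem_Ici.2 le_rfl) (mem_Ici.2 hx) hx
    have h4 : 0 ≤ (g (1 : ℝ)).re := by
      simpa [hg0] using hmono (zero_le_one (α := ℝ))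
    have h5 : Real.exp (-1) ≤ 1 := Real.exp_le_one_iff.2 (by norm_num)
    have h6 := Real.exp_pos (-x)
    simp only [Real.log_one] at h3
    linarith

lemma exists_exp_eq_mul_exp {g : ℂ → ℂ}
    (hg : ∀ z ≠ 0, HasDerivAt g ((1 - Complex.exp (-z)) / z) z) {z : ℂ} (hz : 0 < z.re)
    (hzi : |z.im| ≤ z.re) : ∃ e : ℂ, ‖e‖ ≤ Real.exp (-z.re) ∧
      Complex.exp (g z) = Complex.exp (g z.re) / z.re * (z * Complex.exp e) := by
  have hx0 : (z.re : ℂ) ≠ 0 := by exact_mod_cast hz.ne'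
  have hz0 : z ≠ 0 := fun h => by simp [h] at hz
  have hpos : ∀ w ∈ {w : ℂ | z.re ≤ w.re}, 0 < w.re := fun w hw => hz.trans_le hw
  have hder : ∀ w ∈ {w : ℂ | z.re ≤ w.re}, HasDerivWithinAt (fun w => g w - Complex.log w)
      (-Complex.exp (-w) / w) {w : ℂ | z.re ≤ w.re} w := by
    intro w hw
    have hw0 : w ≠ 0 := fun h => by simpa [h] using hpos w hw
    have := (hg w hw0).sub (Complex.hasDerivAt_log (Or.inl (hpos w hw)))
    refine (this.congr_deriv ?_).hasDerivWithinAt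
    field_simp
    ring
  have hbound := Convex.norm_image_sub_le_of_norm_hasDerivWithin_le
    (C := Real.exp (-z.re) / z.re) (x := (z.re : ℂ)) (y := z) hder (fun w hw => by
      rw [norm_div, norm_neg, Complex.norm_exp]
      have h1 : w.re ≤ ‖w‖ := Complex.re_le_norm w
      have h2 : z.re ≤ w.re := hw
      gcongr
      · simpa using h2
      · linarith) (convex_halfSpace_re_ge z.re) (by simp) (by simp)
  have hsub : z - z.re = z.im * I := by
    apply Complex.ext <;> simp
  refine ⟨_, hbound.trans ?_, ?_⟩
  · rw [hsub, norm_mul, norm_I, mul_one, norm_real, Real.norm_eq_abs, div_mul_eq_mul_div,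
      div_le_iff₀ hz]
    gcongr
  · rw [sub_sub_sub_comm, Complex.exp_sub, Complex.exp_sub, Complex.exp_sub, Complex.exp_log hz0,
      Complex.exp_log hx0]
    have := Complex.exp_ne_zero (g z.re)
    field_simp

/-! ### The example -/

/-- A translate of the sector `|arg z| < π / 4`. -/
def translatedSector : Set ℂ := {z | |z.im| < z.re - 24}

lemma isOpen_translatedSector : IsOpen translatedSector :=
  isOpen_lt (by fun_prop) (by fun_prop)

lemma isPreconnected_translatedSector : IsPreconnected translatedSector := by
  have h : translatedSector = {z : ℂ | 24 < (reCLM + imCLM) z} ∩ {z | 24 < (reCLM - imCLM) z} := by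
    ext z
    simp only [translatedSector, mem_ofPred_eq, mem_inter_iff, abs_lt, add_apply, sub_apply,
      reCLM_apply, imCLM_apply]
    constructor <;> rintro ⟨h1, h2⟩ <;> constructor <;> linarith
  rw [h]
  exact ((convex_halfSpace_gt (reCLM + imCLM).toLinearMap.isLinear 24).inter
    (convex_halfSpace_gt (reCLM - imCLM).toLinearMap.isLinear 24)).isPreconnected

lemma mem_translatedSector_of_norm_sub_le {w v : ℂ} {B : ℝ} (h : ‖v - w‖ ≤ B)
    (hw : |w.im| + 2 * B < w.re - 24) : v ∈ translatedSector := by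
  have h1 := (Complex.abs_re_le_norm (v - w)).trans h
  have h2 := (Complex.abs_im_le_norm (v - w)).trans h
  simp only [sub_re, sub_im, abs_le] at h1 h2
  have h3 := abs_lt.1 (show |w.im| < w.re - 24 - 2 * B by linarith)
  change |v.im| < v.re - 24
  exact abs_lt.2 ⟨by linarith, by linarith⟩

lemma mapsTo_translatedSector {g : ℂ → ℂ} {δ : ℝ}
    (hg : ∀ z ≠ 0, HasDerivAt g ((1 - Complex.exp (-z)) / z) z)
    (hgr : ∀ x : ℝ, 0 ≤ x → g x = ((g x).re : ℂ) ∧ 0 ≤ (g x).re)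
    (hgl : ∀ x : ℝ, 1 ≤ x → Real.log x - 1 ≤ (g x).re) (hδ0 : 0 ≤ δ) (hδ : δ ≤ 1) {z : ℂ}
    (hz : z ∈ translatedSector) :
    100 * Complex.exp (g z + δ * z⁻¹) ∈ translatedSector ∧
      3 / 2 * z.re ≤ (100 * Complex.exp (g z + δ * z⁻¹)).re := by
  have hzs : |z.im| < z.re - 24 := hz
  have hx : 24 < z.re := by linarith [abs_nonneg z.im]
  have hx0 : 0 < z.re := by linarith
  have hzn : z.re ≤ ‖z‖ := Complex.re_le_norm z
  have hzn' : ‖z‖ ≤ 2 * z.re := by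
    refine (Complex.norm_le_abs_re_add_abs_im z).trans ?_
    rw [abs_of_pos hx0]
    linarith
  have hzpos : 0 < ‖z‖ := by linarith
  obtain ⟨e, he, hexp⟩ := exists_exp_eq_mul_exp hg hx0 (by linarith)
  set x := z.re with hxdef
  obtain ⟨hgx, -⟩ := hgr x hx0.le
  set μ : ℝ := 100 * Real.exp (g x).re / x with hμ
  have hμ2 : 2 ≤ μ := by
    have h1 : x * Real.exp (-1) ≤ Real.exp (g x).re := by
      rw [← Real.exp_log hx0, ← Real.exp_add, Real.exp_log hx0]
      exact Real.exp_le_exp.2 (by linarith [hgl x (by linarith)])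
    have h2 : 1 / 3 ≤ Real.exp (-1) := by
      rw [Real.exp_neg, one_div]
      exact inv_anti₀ (Real.exp_pos _) (by linarith [Real.exp_one_lt_d9])
    rw [hμ, le_div_iff₀ hx0]
    nlinarith
  set err : ℂ := e + δ * z⁻¹ with herr
  have herrz : ‖err‖ * ‖z‖ ≤ 3 := by
    have h1 : ‖err‖ ≤ Real.exp (-x) + δ / ‖z‖ := by
      refine (norm_add_le _ _).trans (add_le_add he ?_)
      rw [norm_mul, norm_inv, norm_real, Real.norm_of_nonneg hδ0, div_eq_mul_inv]
    have h2 : x * Real.exp (-x) ≤ 1 := by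
      rw [Real.exp_neg, ← div_eq_mul_inv, div_le_one (Real.exp_pos _)]
      linarith [Real.add_one_le_exp x]
    calc ‖err‖ * ‖z‖ ≤ (Real.exp (-x) + δ / ‖z‖) * ‖z‖ := by gcongr
      _ = Real.exp (-x) * ‖z‖ + δ := by field_simp
      _ ≤ Real.exp (-x) * (2 * x) + 1 := by gcongr
      _ ≤ 3 := by linarith
  have herr1 : ‖err‖ ≤ 1 := by nlinarith [norm_nonneg err]
  set v := z * Complex.exp err with hv
  have hvz : ‖v - z‖ ≤ 6 := by
    have h1 : v - z = (Complex.exp err - 1) * z := by rw [hv]; ring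
    rw [h1, norm_mul]
    have h2 := Complex.norm_exp_sub_one_le herr1
    nlinarith
  have hfz : 100 * Complex.exp (g z + δ * z⁻¹) = (μ : ℂ) * v := by
    rw [Complex.exp_add, hexp, hgx, hv, herr, Complex.exp_add, hμ]
    push_cast
    ring
  have h1 := abs_le.1 ((Complex.abs_re_le_norm (v - z)).trans hvz)
  have h2 := abs_le.1 ((Complex.abs_im_le_norm (v - z)).trans hvz)
  have h3 := abs_lt.1 hzs
  simp only [sub_re, sub_im] at h1 h2
  have h4 : |v.im| < v.re - 12 := abs_lt.2 ⟨by linarith, by linarith⟩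
  rw [hfz]
  refine ⟨?_, ?_⟩
  · change |((μ : ℂ) * v).im| < ((μ : ℂ) * v).re - 24
    rw [im_ofReal_mul, re_ofReal_mul, abs_mul, abs_of_pos (by linarith : 0 < μ)]
    nlinarith
  · rw [re_ofReal_mul]
    nlinarith

/-- There exists a transcendental self-map of `ℂ*` with a doubly connected
(invariant) Baker domain; in fact one containing a circle centred at the origin. -/
theorem exists_doubly_connected_baker_domain :
    ∃ f : ℂ → ℂ, IsTranscendentalSelfMapCStar f ∧
      ∃ U : Set ℂ, IsFatouComponent f U ∧ f '' U ⊆ U ∧ U ⊆ escapingSet f ∧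
        DoublyConnected U ∧ ∃ ρ : ℝ, 0 < ρ ∧ {z : ℂ | ‖z‖ = ρ} ⊆ U := by
  obtain ⟨g, hgd, hg0, hg, hgr, hgl⟩ := exists_entire_near_log
  obtain ⟨ρ, hρ, hρ1, hgρ⟩ : ∃ ρ : ℝ, 0 < ρ ∧ ρ ≤ 1 ∧ ∀ z, ‖z‖ = ρ → ‖g z‖ ≤ 1 / 16 := by
    obtain ⟨r, hr, h⟩ := Metric.continuousAt_iff.1 (hgd 0).continuousAt (1 / 16) (by norm_num)
    refine ⟨min (r / 2) 1, by positivity, min_le_right _ _, fun z hz => ?_⟩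
    have := h (x := z) (by
      rw [dist_zero_right, hz]
      exact (min_le_left _ _).trans_lt (by linarith))
    rw [hg0, dist_zero_right] at this
    exact this.le
  set δ : ℝ := ρ / 16 with hδ
  have hδ0 : 0 < δ := by positivity
  have hδ1 : δ ≤ 1 := by linarith
  set h : ℂ → ℂ := fun w => δ * w + Complex.log 100 with hh
  set G : ℂ → ℂ := fun z => g z + h z⁻¹ with hGdef
  set f : ℂ → ℂ := fun z => Complex.exp (G z) with hfdef
  have hf100 : ∀ z, f z = 100 * Complex.exp (g z + δ * z⁻¹) := by
    intro z
    simp only [hfdef, hGdef, hh]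
    rw [← add_assoc, Complex.exp_add, Complex.exp_log (by norm_num), mul_comm]
  have hG : DifferentiableOn ℂ G {0}ᶜ :=
    hgd.differentiableOn.add (((differentiableOn_inv.mono fun z hz => hz).const_mul _).add_const _)
  have hfd : DifferentiableOn ℂ f {0}ᶜ := hG.cexp
  have hsector : ∀ z ∈ translatedSector, f z ∈ translatedSector ∧ 3 / 2 * z.re ≤ (f z).re := by
    intro z hz
    rw [hf100]
    exact mapsTo_translatedSector hg hgr hgl hδ0.le hδ1 hz
  have hre : ∀ z ∈ translatedSector, 24 < z.re := fun z hz => by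
    have : |z.im| < z.re - 24 := hz
    linarith [abs_nonneg z.im]
  have hiter : ∀ n : ℕ, ∀ z ∈ translatedSector,
      f^[n] z ∈ translatedSector ∧ (3 / 2) ^ n * 24 ≤ (f^[n] z).re := by
    intro n z hz
    induction n with
    | zero => exact ⟨hz, by simpa using (hre z hz).le⟩
    | succ n ih =>
      rw [iterate_succ_apply']
      obtain ⟨h1, h2⟩ := hsector _ ih.1
      refine ⟨h1, le_trans ?_ h2⟩
      rw [pow_succ]
      linarith [ih.2]
  set V : Set ℂ := {0}ᶜ ∩ f ⁻¹' translatedSector with hV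
  have hVo : IsOpen V :=
    hfd.continuousOn.isOpen_inter_preimage isOpen_compl_singleton isOpen_translatedSector
  have hesc : EscapesUniformlyOn f V := by
    intro M
    obtain ⟨N, hN⟩ := pow_unbounded_of_one_lt M (by norm_num : (1 : ℝ) < 3 / 2)
    refine ⟨N + 1, fun n hn w hw => ?_⟩
    obtain ⟨k, rfl⟩ := Nat.exists_eq_add_of_le' hn
    rw [← add_assoc, iterate_succ_apply]
    have h1 := (hiter (k + N) _ hw.2).2
    have h2 : (3 / 2 : ℝ) ^ N ≤ (3 / 2) ^ (k + N) :=
      pow_le_pow_right₀ (by norm_num) (Nat.le_add_left _ _)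
    have h3 : (0 : ℝ) < (3 / 2) ^ (k + N) := by positivity
    have h4 := Complex.re_le_norm (f^[k + N] (f w))
    linarith
  have h25 : (25 : ℂ) ∈ translatedSector := by
    simp [translatedSector]
    norm_num
  have hTV : translatedSector ⊆ V := fun z hz =>
    ⟨fun h0 => by have := hre z hz; rw [mem_singleton_iff.1 h0] at this; norm_num at this,
      (hsector z hz).1⟩
  have hopen : ∀ W : Set ℂ, W ⊆ {0}ᶜ → IsOpen W → IsOpen (f '' W) := by
    have hconn : IsPreconnected ({0}ᶜ : Set ℂ) :=
      (isConnected_compl_singleton_of_one_lt_rank (by simp [rank_real_complex]) 0).isPreconnected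
    refine ((hfd.analyticOnNhd isOpen_compl_singleton).is_constant_or_isOpen
      hconn).resolve_left ?_
    rintro ⟨c, hc⟩
    obtain ⟨N, hN⟩ := hesc ‖c‖
    have h1 := hN (N + 1) (Nat.le_succ N) 25 (hTV h25)
    rw [iterate_succ_apply', hc _ (hTV (hiter N _ h25).1).1] at h1
    exact lt_irrefl _ h1
  set P : Set ℂ := (↑) '' Ioi (0 : ℝ) with hP
  set C : Set ℂ := Metric.sphere 0 ρ with hC
  have hPV : P ⊆ V := by
    rintro _ ⟨x, hx, rfl⟩
    have hx0 : (0 : ℝ) < x := hx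
    refine ⟨by simpa using hx0.ne', ?_⟩
    obtain ⟨h1, h2⟩ := hgr x hx0.le
    have h3 : f x = ((100 * Real.exp ((g x).re + δ * x⁻¹) : ℝ) : ℂ) := by
      rw [hf100, h1]
      push_cast
      rfl
    have h4 : 1 ≤ Real.exp ((g x).re + δ * x⁻¹) := Real.one_le_exp (by positivity)
    rw [mem_preimage, h3]
    change |Complex.im (_ : ℝ)| < Complex.re (_ : ℝ) - 24
    rw [ofReal_im, ofReal_re, abs_zero]
    linarith
  have hCV : C ⊆ V := by
    intro z hz
    have hzρ : ‖z‖ = ρ := mem_sphere_zero_iff_norm.1 hz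
    refine ⟨fun h0 => ?_, ?_⟩
    · rw [mem_singleton_iff.1 h0, norm_zero] at hzρ
      exact hρ.ne hzρ
    · have h1 : ‖g z + δ * z⁻¹‖ ≤ 1 / 8 := by
        have h2 : ‖(δ : ℂ) * z⁻¹‖ = 1 / 16 := by
          rw [norm_mul, norm_inv, norm_real, Real.norm_of_nonneg hδ0.le, hzρ, hδ]
          field_simp
        linarith [norm_add_le (g z) (δ * z⁻¹), hgρ z hzρ]
      have h3 := Complex.norm_exp_sub_one_le (h1.trans (by norm_num))
      rw [mem_preimage, hf100]
      refine mem_translatedSector_of_norm_sub_le (w := 100) (B := 25) ?_ ?_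
      · rw [show 100 * Complex.exp (g z + δ * z⁻¹) - 100 =
          100 * (Complex.exp (g z + δ * z⁻¹) - 1) by ring, norm_mul]
        norm_num
        linarith
      · norm_num
  have hY : IsPreconnected (C ∪ P ∪ translatedSector) := by
    have hCP : IsPreconnected (C ∪ P) :=
      IsPreconnected.union (ρ : ℂ) (by simp [hC, hρ.le]) ⟨ρ, hρ, rfl⟩
        (isPreconnected_sphere (by simp [rank_real_complex]) 0 ρ)
        (isPreconnected_Ioi.image _ continuous_ofReal.continuousOn)
    exact hCP.union (25 : ℂ) (Or.inr ⟨25, by norm_num, by norm_num⟩) h25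
      isPreconnected_translatedSector
  refine ⟨f, ⟨0, g, h, hgd, by fun_prop, ?_, ?_, fun z _ => by simp [hfdef, hGdef]⟩, ?_⟩
  · rintro ⟨c, hc⟩
    have h1 := hg 1 one_ne_zero
    rw [show g = fun _ => c from funext hc] at h1
    have h2 := h1.unique (hasDerivAt_const 1 c)
    rw [div_one, sub_eq_zero] at h2
    have h3 : Real.exp (-1) = 1 := by
      rw [← ofReal_inj, ofReal_exp]
      simpa using h2.symm
    norm_num at h3
  · rintro ⟨c, hc⟩
    have h1 := (hc 1).trans (hc 0).symm
    simp only [hh, mul_one, mul_zero, add_left_inj, ofReal_eq_zero] at h1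
    exact hδ0.ne' h1
  · exact exists_doublyConnected_fatouComponent hG (fun z _ => rfl) hopen hVo
      (fun w hw => hw.1) hesc hY (union_subset (union_subset hCV hPV) hTV) (Or.inr h25)
      (Or.inr (hsector _ h25).1) hρ
      fun z hz => Or.inl (Or.inl (mem_sphere_zero_iff_norm.2 hz))
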